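/- Let Γ be a regular nicely distance-balanced graph with valency k = 4, diameter d ≥ 3 and γ(Γ) = d+1. Then d ≠ 4. -/

import Mathlib

open SimpleGraph Finset

/-- `W_{u,v}`: the set of vertices strictly closer to `u` than to `v`. -/
noncomputable def ndbW {V : Type*} [Fintype V] (G : SimpleGraph V) (u v : V) : Finset V :=
  Finset.univ.filter fun x => G.dist x u < G.dist x v

/-- `D^i_j(u,v)`: the set of vertices at distance `i` from `u` and `j` from `v`. -/
noncomputable def ndbD {V : Type*} [Fintype V] (G : SimpleGraph V) (u v : V) (i j : ℕ) : Finset V :=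
  Finset.univ.filter fun x => G.dist x u = i ∧ G.dist x v = j

/-- `G` is nicely distance-balanced with constant `γ`. -/
def IsNDB {V : Type*} [Fintype V] (G : SimpleGraph V) (γ : ℕ) : Prop :=
  ∀ u v : V, G.Adj u v → (ndbW G u v).card = γ ∧ (ndbW G v u).card = γ

/-- `G` has diameter `d`. -/
def HasDiam {V : Type*} [Fintype V] (G : SimpleGraph V) (d : ℕ) : Prop :=
  (∀ u v : V, G.dist u v ≤ d) ∧ ∃ u v : V, G.dist u v = d

/-! Proof by a verified search.  A partially explored graph has named vertices `1..n`, a matrix `A` of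
known edges and a matrix `N` of known non-edges (index `0` stands for every unnamed vertex), both
stored as bits of a natural number, row width 32. -/

def bitM (M i j : ℕ) : Bool := M.testBit (32 * i + j)

def addP (M i j : ℕ) : ℕ := M ||| (1 <<< (32 * i + j)) ||| (1 <<< (32 * j + i))

def mkMask (p : ℕ → Bool) : ℕ → ℕ
  | 0 => if p 0 then 1 else 0
  | n + 1 => if p (n + 1) then mkMask p n ||| (1 <<< (n + 1)) else mkMask p n

def kstep (A n K : ℕ) : ℕ :=
  mkMask (fun j => K.testBit j || !(Nat.beq ((A >>> (32 * j)) &&& K) 0)) n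

def pstep (N n P : ℕ) : ℕ :=
  mkMask (fun j => P.testBit j || !(Nat.beq (P &&& (N >>> (32 * j))) P)) n

def kball (A n u : ℕ) : ℕ → ℕ
  | 0 => 1 <<< u
  | r + 1 => kstep A n (kball A n u r)

def pball (N n u : ℕ) : ℕ → ℕ
  | 0 => 1 <<< u
  | r + 1 => pstep N n (pball N n u r)

/-- vertices certainly closer to `u` than to `v` -/
def cmask (A N n u v : ℕ) : ℕ → ℕ
  | 0 => 0
  | r + 1 => cmask A N n u v r ||| ((kball A n u r &&& pball N n v r) ^^^ kball A n u r)

def addL (N v : ℕ) : List ℕ → ℕ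
  | [] => N
  | j :: l => addP (addL N v l) v j

def sw (j k a : ℕ) : ℕ := if a = j then k else if a = k then j else a

def rowCard (A n v : ℕ) : ℕ := ((Finset.range (n + 1)).filter fun j => bitM A v j = true).card

def closeAux (A N v : ℕ) : ℕ → ℕ
  | 0 => N
  | m + 1 => if bitM A v m then closeAux A N v m else addP (closeAux A N v m) v m

def closeN (A N n v : ℕ) : ℕ := if rowCard A n v = 4 then closeAux A N v (n + 1) else N

def newAux (N k : ℕ) : ℕ → ℕ
  | 0 => N
  | m + 1 => if bitM N 0 m then addP (newAux N k m) k m else newAux N k m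

def twinOK (n A N j k : ℕ) : Prop :=
  ∀ a ∈ Finset.range (n + 1), ∀ b ∈ Finset.range (n + 1),
    bitM A (sw j k a) (sw j k b) = bitM A a b ∧ bitM N (sw j k a) (sw j k b) = bitM N a b

instance (n A N j k : ℕ) : Decidable (twinOK n A N j k) := by unfold twinOK; infer_instance

def okIdx (n v : ℕ) : Prop := 1 ≤ v ∧ v ≤ n

instance (n v : ℕ) : Decidable (okIdx n v) := by unfold okIdx; infer_instance

def newOK (n A N v : ℕ) : Prop :=
  ∀ j ∈ Finset.range (n + 1), (Nat.beq j 0 || bitM A v j || bitM N v j) = true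

instance (n A N v : ℕ) : Decidable (newOK n A N v) := by unfold newOK; infer_instance

inductive Ct
  | S : Ct
  | L : ℕ → ℕ → Ct
  | B : ℕ → ℕ → List ℕ → Ct → Ct → Ct
  | N : ℕ → Ct → Ct

def check : Ct → ℕ → ℕ → ℕ → Bool
  | .S, n, A, _ => (kball A n 1 3).testBit 5
  | .L u v, n, A, N => bitM A u v && decide (u < 32) && decide (v < 32) &&
      decide (6 ≤ ((Finset.range (n + 1)).filter fun b => (cmask A N n u v 4).testBit b = true).card)
  | .B v j l x y, n, A, N =>
      decide (okIdx n v) && decide (okIdx n j) && decide (v ≠ j) &&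
      decide (∀ k ∈ l, okIdx n k ∧ k ≠ v ∧ j ≠ 1 ∧ j ≠ 5 ∧ k ≠ 1 ∧ k ≠ 5 ∧ twinOK n A N j k) &&
      check x n (addP A v j) (closeN (addP A v j) (closeN (addP A v j) N n v) n j) &&
      check y n A (addL (addP N v j) v l)
  | .N v x, n, A, N =>
      decide (okIdx n v) && decide (n + 1 < 32) && decide (rowCard A n v < 4) &&
      decide (newOK n A N v) &&
      check x (n + 1) (addP A v (n + 1))
        (closeN (addP A v (n + 1)) (addP (newAux N (n + 1) (n + 1)) (n + 1) (n + 1)) (n + 1) v)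

def ctree : Ct :=
 (.B 1 5 [] .S
 (.B 1 3 [] .S
 (.B 1 4 [] .S
 (.N 1 (.N 1 (.N 1 (.B 2 4 [] .S
 (.B 2 5 [] .S
 (.B 3 5 [] .S
 (.B 5 6 [7, 8] .S
 (.N 5 (.N 5 (.N 5 (.B 4 6 [7, 8] .S
 (.B 4 9 [10, 11] (.B 10 6 [7, 8] .S
 (.B 11 6 [7, 8] .S
 (.B 9 6 [7, 8] .S
 (.B 3 10 [11] (.B 2 9 [] .S
 (.B 2 10 [] .S
 (.B 2 11 [] .S
 (.B 2 6 [7, 8] (.B 2 7 [8] (.B 3 6 [7] (.B 4 10 [] (.B 6 7 [] (.B 9 10 [] (.B 7 8 [] (.L 3 2)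
 (.N 7 (.B 9 11 [] (.L 1 8)
 (.B 11 12 [] (.N 11 (.N 11 (.L 11 5)))
 (.L 3 2)))))
 (.B 10 11 [] (.L 3 2)
 (.N 10 (.L 10 5))))
 (.B 6 8 [] (.L 3 4)
 (.N 6 (.L 6 1))))
 (.B 4 11 [] (.L 3 2)
 (.N 4 (.L 4 5))))
 (.B 3 8 [] (.L 3 2)
 (.B 3 9 [] (.L 2 1)
 (.B 3 11 [] (.L 2 1)
 (.N 3 (.L 3 2))))))
 (.N 2 (.L 2 1)))
 (.N 2 (.L 2 1))))))
 (.B 2 6 [7, 8] (.B 2 10 [11] .S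
 (.B 4 10 [11] (.B 2 7 [8] (.B 3 6 [7] (.B 3 7 [] (.L 4 5)
 (.B 3 8 [] (.L 3 2)
 (.B 3 9 [] (.B 6 7 [] (.B 9 10 [] (.B 7 8 [] (.L 3 2)
 (.N 7 (.B 10 11 [] (.L 1 8)
 (.B 11 12 [] (.N 11 (.N 11 (.L 11 5)))
 (.L 3 2)))))
 (.B 9 11 [] (.L 3 2)
 (.N 9 (.L 9 5))))
 (.B 6 8 [] (.L 3 4)
 (.N 6 (.L 6 1))))
 (.N 3 (.L 3 2)))))
 (.B 3 8 [] (.L 3 4)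
 (.B 3 9 [] (.N 3 (.L 3 2))
 (.N 3 (.L 3 2)))))
 (.B 3 9 [] (.B 2 9 [] .S
 (.N 2 (.L 2 1)))
 (.B 3 6 [] (.B 2 9 [] .S
 (.N 2 (.B 12 9 [10] (.L 2 1)
 (.B 11 12 [] (.L 2 1)
 (.B 3 7 [8] (.L 3 2)
 (.B 3 12 [] (.L 4 5)
 (.N 3 (.L 3 2))))))))
 (.B 3 7 [8] (.B 3 8 [] (.L 3 4)
 (.N 3 (.L 3 4)))
 (.N 3 (.N 3 (.L 3 4)))))))
 (.B 3 7 [8] (.N 4 (.B 2 9 [] .S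
 (.L 4 5)))
 (.N 4 (.B 6 12 [] (.B 2 9 [] .S
 (.L 4 5))
 (.B 12 7 [8] (.B 2 9 [] .S
 (.L 4 5))
 (.B 2 7 [8] (.B 3 6 [] (.L 4 5)
 (.B 3 9 [] (.B 3 12 [] (.L 2 1)
 (.N 3 (.L 3 2)))
 (.B 3 12 [] (.N 3 (.L 3 2))
 (.N 3 (.L 3 2)))))
 (.B 2 9 [] .S
 (.B 3 9 [] (.B 2 12 [] (.L 2 1)
 (.N 2 (.L 2 1)))
 (.B 3 6 [] (.L 4 5)
 (.B 3 12 [] (.B 2 12 [] (.N 3 (.B 13 7 [8] (.L 3 4)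
 (.B 13 10 [11] (.B 9 12 [] (.L 2 1)
 (.B 10 12 [] (.L 2 1)
 (.L 3 2)))
 (.B 6 13 [] (.B 9 12 [] (.L 2 1)
 (.B 9 13 [] (.B 12 10 [11] (.L 2 1)
 (.B 12 13 [] (.L 13 6)
 (.N 12 (.B 10 14 [] (.L 12 2)
 (.B 6 14 [] (.L 3 2)
 (.B 14 7 [8] (.L 12 4)
 (.L 2 1)))))))
 (.L 4 5)))
 (.L 2 1)))))
 (.N 2 (.L 2 1)))
 (.N 3 (.N 3 (.L 3 4))))))))))))))
 (.B 2 9 [] .S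
 (.B 2 10 [11] .S
 (.N 2 (.N 2 (.L 2 1))))))))))
 (.B 9 6 [7, 8] .S
 (.B 10 6 [7, 8] .S
 (.B 2 9 [10] .S
 (.B 11 6 [7, 8] .S
 (.N 4 (.N 4 (.B 2 11 [] .S
 (.L 4 5)))))))))))))))))))))))
def initA : ℕ := addP (addP (addP (addP 0 1 2) 2 3) 3 4) 4 5
def initN : ℕ := addP (addP (addP (addP (addP 0 1 1) 2 2) 3 3) 4 4) 5 5

theorem check_ctree : check ctree 5 initA initN = true := by decide +kernel

theorem bitM_addP (M i j a b : ℕ) (hi : i < 32) (hj : j < 32) (ha : a < 32) (hb : b < 32) :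
    bitM (addP M i j) a b = true ↔ (bitM M a b = true ∨ (a = i ∧ b = j) ∨ (a = j ∧ b = i)) := by
  unfold bitM addP
  simp only [Nat.testBit_or, Nat.one_shiftLeft, Nat.testBit_two_pow, Bool.or_eq_true, decide_eq_true_eq]
  have h1 : 32 * i + j = 32 * a + b ↔ (a = i ∧ b = j) := by omega
  have h2 : 32 * j + i = 32 * a + b ↔ (a = j ∧ b = i) := by omega
  rw [h1, h2, or_assoc]

theorem testBit_mkMask (p : ℕ → Bool) (n b : ℕ) :
    (mkMask p n).testBit b = true ↔ b ≤ n ∧ p b = true := by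
  induction n with
  | zero =>
    unfold mkMask
    by_cases h : p 0
    · simp only [h, if_true, Nat.testBit_one_eq_true_iff_self_eq_zero]
      constructor
      · rintro rfl; exact ⟨le_rfl, h⟩
      · rintro ⟨h, _⟩; omega
    · simp only [h]
      simp
      rintro rfl
      simpa using h
  | succ n ih =>
    unfold mkMask
    by_cases h : p (n + 1)
    · simp only [h, if_true, Nat.testBit_or, Nat.one_shiftLeft, Nat.testBit_two_pow, Bool.or_eq_true,
        decide_eq_true_eq, ih]
      constructor
      · rintro (⟨h1, h2⟩ | rfl)
        · exact ⟨by omega, h2⟩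
        · exact ⟨le_rfl, h⟩
      · rintro ⟨h1, h2⟩
        by_cases h3 : n + 1 = b
        · exact Or.inr h3
        · exact Or.inl ⟨by omega, h2⟩
    · simp only [h]
      simp only [Bool.false_eq_true, if_false, ih]
      constructor
      · rintro ⟨h1, h2⟩; exact ⟨by omega, h2⟩
      · rintro ⟨h1, h2⟩
        refine ⟨?_, h2⟩
        rcases Nat.lt_or_ge n b with h3 | h3
        · obtain rfl : b = n + 1 := by omega
          exact absurd h2 h
        · exact h3

structure Rlz {V : Type*} (G : SimpleGraph V) (n A N : ℕ) (f : ℕ → V) (g : V → ℕ) : Prop where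
  hn : n < 32
  h5 : 5 ≤ n
  g_le : ∀ x, g x ≤ n
  fg : ∀ x, g x ≠ 0 → f (g x) = x
  gf : ∀ i, 1 ≤ i → i ≤ n → g (f i) = i
  hA : ∀ i j, i < 32 → j < 32 → bitM A i j = true → okIdx n i ∧ okIdx n j ∧ G.Adj (f i) (f j)
  hN : ∀ x y, bitM N (g x) (g y) = true → ¬ G.Adj x y
  hNn : ∀ i j, i < 32 → j < 32 → bitM N i j = true → i ≤ n ∧ j ≤ n
  h15 : G.dist (f 1) (f 5) = 4

section
variable {V : Type*} {G : SimpleGraph V} {n A N : ℕ} {f : ℕ → V} {g : V → ℕ}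

theorem Rlz.addA (h : Rlz G n A N f g) {v j : ℕ} (hv : okIdx n v) (hj : okIdx n j)
    (hadj : G.Adj (f v) (f j)) : Rlz G n (addP A v j) N f g := by
  have hn := h.hn
  refine { h with hA := ?_ }
  intro a b ha hb hab
  have hv2 := hv.2
  have hj2 := hj.2
  rw [bitM_addP _ _ _ _ _ (by omega) (by omega) ha hb] at hab
  rcases hab with hab | ⟨rfl, rfl⟩ | ⟨rfl, rfl⟩
  · exact h.hA a b ha hb hab
  · exact ⟨hv, hj, hadj⟩
  · exact ⟨hj, hv, hadj.symm⟩

theorem Rlz.addN (h : Rlz G n A N f g) {v j : ℕ} (hv : v ≤ n) (hj : j ≤ n)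
    (hadj : ∀ x y, g x = v → g y = j → ¬ G.Adj x y) : Rlz G n A (addP N v j) f g := by
  have hn := h.hn
  refine { h with hN := ?_, hNn := ?_ }
  · intro x y hxy
    have h1 := h.g_le x
    have h2 := h.g_le y
    rw [bitM_addP _ _ _ _ _ (by omega) (by omega) (by omega) (by omega)] at hxy
    rcases hxy with hxy | ⟨h1, h2⟩ | ⟨h1, h2⟩
    · exact h.hN x y hxy
    · exact hadj x y h1 h2
    · exact fun hh => hadj y x h2 h1 hh.symm
  · intro a b ha hb hab
    rw [bitM_addP _ _ _ _ _ (by omega) (by omega) (by omega) (by omega)] at hab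
    rcases hab with hxy | ⟨h1, h2⟩ | ⟨h1, h2⟩
    · exact h.hNn a b ha hb hxy
    · omega
    · omega

theorem Rlz.addNf (h : Rlz G n A N f g) {v j : ℕ} (hv : okIdx n v) (hj : okIdx n j)
    (hadj : ¬ G.Adj (f v) (f j)) : Rlz G n A (addP N v j) f g := by
  refine h.addN hv.2 hj.2 ?_
  intro x y hx hy
  have h1 := h.fg x (by have := hv.1; omega)
  have h2 := h.fg y (by have := hj.1; omega)
  rw [← h1, ← h2, hx, hy]
  exact hadj

theorem Rlz.addLf (h : Rlz G n A N f g) {v : ℕ} (hv : okIdx n v) (l : List ℕ)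
    (hl : ∀ j ∈ l, okIdx n j ∧ ¬ G.Adj (f v) (f j)) : Rlz G n A (addL N v l) f g := by
  induction l with
  | nil => exact h
  | cons j l ih =>
    unfold addL
    have h1 := hl j (by simp)
    exact (ih (fun k hk => hl k (by simp [hk]))).addNf hv h1.1 h1.2

theorem f_inj (h : Rlz G n A N f g) {a b : ℕ} (ha : okIdx n a) (hb : okIdx n b) (hab : f a = f b) :
    a = b := by
  rw [← h.gf a ha.1 ha.2, ← h.gf b hb.1 hb.2, hab]

theorem Rlz.closeAux (h : Rlz G n A N f g) {v : ℕ} (hv : okIdx n v)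
    (hcl : ∀ y, G.Adj (f v) y → bitM A v (g y) = true) (m : ℕ) (hm : m ≤ n + 1) :
    Rlz G n A (closeAux A N v m) f g := by
  induction m with
  | zero => exact h
  | succ m ih =>
    unfold _root_.closeAux
    have ih := ih (by omega)
    split
    · exact ih
    · rename_i hb
      refine ih.addN hv.2 (by omega) ?_
      intro x y hx hy hxy
      have h1 := h.fg x (by have := hv.1; omega)
      rw [hx] at h1
      rw [← h1] at hxy
      have := hcl y hxy
      rw [hy] at this
      exact hb this

theorem Rlz.closeN [Fintype V] [DecidableRel G.Adj] (hreg : G.IsRegularOfDegree 4)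
    (h : Rlz G n A N f g) {v : ℕ} (hv : okIdx n v) :
    Rlz G n A (closeN A N n v) f g := by
  classical
  have hn := h.hn
  have hv2 := hv.2
  unfold _root_.closeN
  split
  · rename_i hc
    refine h.closeAux hv ?_ _ le_rfl
    have hbd : ∀ j, j ∈ ((Finset.range (n + 1)).filter fun j => bitM A v j = true) →
        okIdx n j ∧ G.Adj (f v) (f j) ∧ bitM A v j = true := by
      intro j hj
      simp only [Finset.mem_filter, Finset.mem_range] at hj
      have := h.hA v j (by omega) (by omega) hj.2
      exact ⟨this.2.1, this.2.2, hj.2⟩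
    have heq : ((Finset.range (n + 1)).filter fun j => bitM A v j = true).image f
        = G.neighborFinset (f v) := by
      apply Finset.eq_of_subset_of_card_le
      · intro x hx
        rw [Finset.mem_image] at hx
        obtain ⟨j, hj, rfl⟩ := hx
        rw [mem_neighborFinset]
        exact (hbd j hj).2.1
      · rw [Finset.card_image_of_injOn, card_neighborFinset_eq_degree, hreg (f v)]
        · exact hc.ge
        · intro a ha b hb hab
          exact f_inj h (hbd a ha).1 (hbd b hb).1 hab
    intro y hy
    have : y ∈ G.neighborFinset (f v) := by rwa [mem_neighborFinset]
    rw [← heq, Finset.mem_image] at this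
    obtain ⟨j, hj, rfl⟩ := this
    have := hbd j hj
    rw [h.gf j this.1.1 this.1.2]
    exact this.2.2
  · exact h

theorem sw_sw (j k a : ℕ) : sw j k (sw j k a) = a := by
  unfold sw; split_ifs <;> omega

theorem sw_le {j k : ℕ} (hj : okIdx n j) (hk : okIdx n k) {a : ℕ} (ha : a ≤ n) : sw j k a ≤ n := by
  have := hj.2
  have := hk.2
  unfold sw; split_ifs <;> omega

theorem sw_pos {j k : ℕ} (hj : okIdx n j) (hk : okIdx n k) {a : ℕ} (ha : 1 ≤ a) : 1 ≤ sw j k a := by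
  have := hj.1
  have := hk.1
  unfold sw; split_ifs <;> omega

theorem Rlz.swap (h : Rlz G n A N f g) {j k : ℕ} (hj : okIdx n j) (hk : okIdx n k)
    (hj1 : j ≠ 1) (hj5 : j ≠ 5) (hk1 : k ≠ 1) (hk5 : k ≠ 5) (ht : twinOK n A N j k) :
    Rlz G n A N (fun a => f (sw j k a)) (fun x => sw j k (g x)) where
  hn := h.hn
  h5 := h.h5
  g_le x := sw_le hj hk (h.g_le x)
  fg x hx := by
    simp only [sw_sw]
    apply h.fg
    intro h0
    apply hx
    rw [h0]
    have := hj.1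
    have := hk.1
    unfold sw; split_ifs <;> omega
  gf i h1 h2 := by
    rw [h.gf _ (sw_pos hj hk h1) (sw_le hj hk h2), sw_sw]
  hA a b ha hb hab := by
    have h1 := h.hA a b ha hb hab
    have ha2 := h1.1.2
    have hb2 := h1.2.1.2
    have hn := h.hn
    have h2 := (ht a (by simp; omega) b (by simp; omega)).1
    rw [hab] at h2
    have h3 := h.hA _ _ (lt_of_le_of_lt (sw_le hj hk ha2) hn) (lt_of_le_of_lt (sw_le hj hk hb2) hn) h2
    exact ⟨h1.1, h1.2.1, h3.2.2⟩
  hN x y hxy := by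
    have h1 := h.g_le x
    have h2 := h.g_le y
    have h3 := (ht (g x) (by simp; omega) (g y) (by simp; omega)).2
    rw [hxy] at h3
    exact h.hN x y h3.symm
  hNn := h.hNn
  h15 := by
    have h1 : sw j k 1 = 1 := by unfold sw; split_ifs <;> omega
    have h5 : sw j k 5 = 5 := by unfold sw; split_ifs <;> omega
    rw [h1, h5]
    exact h.h15

theorem bitM_newAux (N k m a b : ℕ) (hk : k < 32) (hm : m ≤ 32) (ha : a < 32) (hb : b < 32)
    (h : bitM (newAux N k m) a b = true) :
    bitM N a b = true ∨ (a = k ∧ bitM N 0 b = true) ∨ (b = k ∧ bitM N 0 a = true) := by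
  induction m with
  | zero => exact Or.inl h
  | succ m ih =>
    unfold newAux at h
    split at h
    · rename_i h0
      rw [bitM_addP _ _ _ _ _ (by omega) (by omega) (by omega) (by omega)] at h
      rcases h with h | ⟨rfl, rfl⟩ | ⟨rfl, rfl⟩
      · exact ih (by omega) h
      · exact Or.inr (Or.inl ⟨rfl, h0⟩)
      · exact Or.inr (Or.inr ⟨rfl, h0⟩)
    · exact ih (by omega) h

theorem Rlz.new (h : Rlz G n A N f g) (hn1 : n + 1 < 32) {w : V} (hw : g w = 0) {v : ℕ}
    (hv : okIdx n v) (hvw : G.Adj (f v) w) :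
    ∃ f' g', Rlz G (n + 1) (addP A v (n + 1))
      (addP (newAux N (n + 1) (n + 1)) (n + 1) (n + 1)) f' g' := by
  classical
  have h5 := h.h5
  refine ⟨fun i => if i = n + 1 then w else f i, fun x => if x = w then n + 1 else g x, ?_⟩
  have base : Rlz G (n + 1) A (newAux N (n + 1) (n + 1)) (fun i => if i = n + 1 then w else f i)
      (fun x => if x = w then n + 1 else g x) := by
    refine ⟨hn1, by omega, ?_, ?_, ?_, ?_, ?_, ?_, ?_⟩
    · intro x
      have := h.g_le x
      try dsimp only
      split_ifs <;> omega
    · intro x hx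
      try dsimp only at hx ⊢
      by_cases hxw : x = w
      · simp [hxw]
      · simp only [hxw, if_false] at hx ⊢
        have := h.g_le x
        rw [if_neg (by omega)]
        exact h.fg x hx
    · intro i h1 h2
      try dsimp only
      by_cases hi : i = n + 1
      · simp [hi]
      · simp only [hi, if_false]
        have h3 := h.gf i h1 (by omega)
        rw [if_neg, h3]
        intro h4
        rw [h4] at h3
        omega
    · intro i j hi hj hij
      obtain ⟨h1, h2, h3⟩ := h.hA i j hi hj hij
      have h12 := h1.2
      have h22 := h2.2
      refine ⟨⟨h1.1, by omega⟩, ⟨h2.1, by omega⟩, ?_⟩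
      try dsimp only
      rw [if_neg (by omega), if_neg (by omega)]
      exact h3
    · intro x y hxy
      have hx := h.g_le x
      have hy := h.g_le y
      have := bitM_newAux N (n + 1) (n + 1) _ _ hn1 (by omega) (by (try dsimp only); split_ifs <;> omega)
        (by (try dsimp only); split_ifs <;> omega) hxy
      have big : ∀ c, c < 32 → ¬ bitM N (n + 1) c = true := by
        intro c hc hb
        have := (h.hNn _ _ hn1 hc hb).1
        omega
      have big2 : ∀ c, c < 32 → ¬ bitM N c (n + 1) = true := by
        intro c hc hb
        have := (h.hNn _ _ hc hn1 hb).2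
        omega
      by_cases hxw : x = w
      · by_cases hyw : y = w
        · rw [hxw, hyw]; exact G.loopless.irrefl w
        · simp only [hxw, hyw, if_true, if_false] at this
          rcases this with this | ⟨_, this⟩ | ⟨this, _⟩
          · exact absurd this (big _ (by omega))
          · apply h.hN; rw [hxw, hw]; exact this
          · omega
      · by_cases hyw : y = w
        · simp only [hxw, hyw, if_true, if_false] at this
          rcases this with this | ⟨this, _⟩ | ⟨_, this⟩
          · exact absurd this (big2 _ (by omega))
          · omega
          · intro hadj
            refine h.hN y x ?_ hadj.symm
            rw [hyw, hw]; exact this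
        · simp only [hxw, hyw, if_false] at this
          rcases this with this | ⟨this, _⟩ | ⟨this, _⟩
          · exact h.hN x y this
          · omega
          · omega
    · intro a b ha hb hab
      rcases bitM_newAux N (n + 1) (n + 1) _ _ hn1 (by omega) ha hb hab with h1 | ⟨h1, h2⟩ | ⟨h1, h2⟩
      · have := h.hNn a b ha hb h1
        omega
      · have := (h.hNn 0 b (by omega) hb h2).2
        omega
      · have := (h.hNn 0 a (by omega) ha h2).2
        omega
    · try dsimp only
      rw [if_neg (by omega), if_neg (by omega)]
      exact h.h15
  have hv2 := hv.2
  refine (base.addA (v := v) (j := n + 1) ⟨hv.1, by omega⟩ ⟨by omega, le_rfl⟩ ?_).addNf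
    ⟨by omega, le_rfl⟩ ⟨by omega, le_rfl⟩ (G.loopless.irrefl _)
  try dsimp only
  rw [if_neg (by omega), if_pos rfl]
  exact hvw

theorem kball_sound (h : Rlz G n A N f g) (hconn : G.Connected) {u : ℕ} (hu : okIdx n u) (r : ℕ) :
    ∀ b, (kball A n u r).testBit b = true → okIdx n b ∧ G.dist (f b) (f u) ≤ r := by
  have hn := h.hn
  induction r with
  | zero =>
    intro b hb
    unfold kball at hb
    rw [Nat.one_shiftLeft, Nat.testBit_two_pow, decide_eq_true_eq] at hb
    subst hb
    exact ⟨hu, by simp⟩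
  | succ r ih =>
    intro b hb
    unfold kball kstep at hb
    rw [testBit_mkMask, Bool.or_eq_true] at hb
    obtain ⟨hbn, hb | hb⟩ := hb
    · have := ih b hb
      exact ⟨this.1, by omega⟩
    · have hne : (A >>> (32 * b)) &&& kball A n u r ≠ 0 := by
        intro h0
        rw [h0] at hb
        simp at hb
      obtain ⟨c, hc⟩ := Nat.exists_testBit_of_ne_zero hne
      rw [Nat.testBit_and, Bool.and_eq_true, Nat.testBit_shiftRight] at hc
      have h1 := ih c hc.2
      have h12 := h1.1.2
      have h2 := h.hA b c (by omega) (by omega) hc.1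
      refine ⟨h2.1, ?_⟩
      have h3 := hconn.dist_triangle (u := f b) (v := f c) (w := f u)
      have h4 : G.dist (f b) (f c) = 1 := dist_eq_one_iff_adj.mpr h2.2.2
      omega

theorem exists_step (hconn : G.Connected) {x v : V} {r : ℕ} (h : G.dist x v = r + 1) :
    ∃ y, G.Adj x y ∧ G.dist y v ≤ r := by
  obtain ⟨p, hp⟩ := hconn.exists_walk_length_eq_dist x v
  cases p with
  | nil => simp at h
  | cons hadj q =>
    refine ⟨_, hadj, ?_⟩
    have := dist_le q
    rw [SimpleGraph.Walk.length_cons] at hp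
    omega

theorem pball_sound (h : Rlz G n A N f g) (hconn : G.Connected) {u : ℕ} (hu : okIdx n u) (r : ℕ) :
    ∀ x, G.dist x (f u) ≤ r → (pball N n u r).testBit (g x) = true := by
  induction r with
  | zero =>
    intro x hx
    have : x = f u := (hconn.dist_eq_zero_iff).mp (by omega)
    subst this
    rw [h.gf u hu.1 hu.2]
    unfold pball
    rw [Nat.one_shiftLeft, Nat.testBit_two_pow, decide_eq_true_eq]
  | succ r ih =>
    intro x hx
    unfold pball pstep
    rw [testBit_mkMask, Bool.or_eq_true]
    refine ⟨h.g_le x, ?_⟩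
    rcases Nat.lt_or_ge r (G.dist x (f u)) with h1 | h1
    · right
      obtain ⟨y, hxy, hy⟩ := exists_step hconn (show G.dist x (f u) = r + 1 by omega)
      have h2 := ih y hy
      by_contra hb
      have hb : pball N n u r &&& N >>> (32 * g x) = pball N n u r := by
        simpa using hb
      have h3 := congrArg (fun M => M.testBit (g y)) hb
      simp only [Nat.testBit_and, h2, Nat.testBit_shiftRight, Bool.true_and] at h3
      exact h.hN x y h3 hxy
    · left
      exact ih x h1

theorem cmask_sound (h : Rlz G n A N f g) (hconn : G.Connected) {u v : ℕ} (hu : okIdx n u)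
    (hv : okIdx n v) (r : ℕ) :
    ∀ b, (cmask A N n u v r).testBit b = true →
      okIdx n b ∧ G.dist (f b) (f u) < G.dist (f b) (f v) := by
  induction r with
  | zero => intro b hb; simp [cmask] at hb
  | succ r ih =>
    intro b hb
    unfold cmask at hb
    rw [Nat.testBit_or, Bool.or_eq_true] at hb
    rcases hb with hb | hb
    · exact ih b hb
    · rw [Nat.testBit_xor, Nat.testBit_and] at hb
      have hk : (kball A n u r).testBit b = true := by
        by_contra hk
        simp [hk] at hb
      have hp : ¬ (pball N n v r).testBit b = true := by
        intro hp
        simp [hk, hp] at hb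
      obtain ⟨h1, h2⟩ := kball_sound h hconn hu r b hk
      refine ⟨h1, ?_⟩
      by_contra h3
      apply hp
      have := pball_sound h hconn hv r (f b) (by omega)
      rwa [h.gf b h1.1 h1.2] at this

end

theorem check_sound {V : Type*} [Fintype V] (G : SimpleGraph V) [DecidableRel G.Adj]
    (hconn : G.Connected) (hreg : G.IsRegularOfDegree 4) (hndb : IsNDB G 5) (c : Ct) :
    ∀ (n A N : ℕ) (f : ℕ → V) (g : V → ℕ), Rlz G n A N f g → check c n A N = true → False := by
  classical
  induction c with
  | S =>
    intro n A N f g h hc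
    unfold check at hc
    have h5 := h.h5
    have := (kball_sound h hconn (u := 1) ⟨le_rfl, by omega⟩ 3 5 hc).2
    rw [G.dist_comm, h.h15] at this
    omega
  | L u v =>
    intro n A N f g h hc
    unfold check at hc
    simp only [Bool.and_eq_true, decide_eq_true_eq] at hc
    obtain ⟨⟨⟨h1, h2⟩, h3⟩, h4⟩ := hc
    obtain ⟨hu, hv, hadj⟩ := h.hA u v h2 h3 h1
    have hs := cmask_sound h hconn hu hv 4
    have hW := (hndb _ _ hadj).1
    have : ((Finset.range (n + 1)).filter fun b => (cmask A N n u v 4).testBit b = true).card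
        ≤ (ndbW G (f u) (f v)).card := by
      apply Finset.card_le_card_of_injOn f
      · intro b hb
        have hb := (Finset.mem_filter.mp hb).2
        simp only [ndbW, Finset.coe_filter, Set.mem_ofPred_eq, Finset.mem_univ, true_and]
        exact (hs b hb).2
      · intro a ha b hb hab
        exact f_inj h (hs a (Finset.mem_filter.mp ha).2).1 (hs b (Finset.mem_filter.mp hb).2).1 hab
    omega
  | B v j l x y ihx ihy =>
    intro n A N f g h hc
    unfold check at hc
    simp only [Bool.and_eq_true, decide_eq_true_eq] at hc
    obtain ⟨⟨⟨⟨⟨hv, hj⟩, hvj⟩, hl⟩, hx⟩, hy⟩ := hc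
    have key : ∀ f g, Rlz G n A N f g → ¬ G.Adj (f v) (f j) := by
      intro f g h hadj
      exact ihx _ _ _ f g (((h.addA hv hj hadj).closeN hreg hv).closeN hreg hj) hx
    refine ihy _ _ _ f g ((h.addNf hv hj (key f g h)).addLf hv l ?_) hy
    intro k hk
    obtain ⟨h1, h2, h3, h4, h5, h6, h7⟩ := hl k hk
    refine ⟨h1, ?_⟩
    have := key _ _ (h.swap hj h1 h3 h4 h5 h6 h7)
    have e1 : sw j k v = v := by unfold sw; split_ifs <;> omega
    have e2 : sw j k j = k := by unfold sw; simp
    simpa only [e1, e2] using this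
  | N v x ih =>
    intro n A N f g h hc
    unfold check at hc
    simp only [Bool.and_eq_true, decide_eq_true_eq] at hc
    obtain ⟨⟨⟨⟨hv, hn1⟩, hcard⟩, hok⟩, hx⟩ := hc
    have : ∃ w, G.Adj (f v) w ∧ g w = 0 := by
      by_contra hcon
      push Not at hcon
      have hle : (G.neighborFinset (f v)).card ≤ rowCard A n v := by
        apply Finset.card_le_card_of_injOn g
        · intro y hy
          have hy : G.Adj (f v) y := by simpa using hy
          have h0 := hcon y hy
          have h1 := h.g_le y
          have h2 := hok (g y) (by simp; omega)
          simp only [Finset.coe_filter, Set.mem_ofPred_eq, Finset.mem_range]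
          refine ⟨by omega, ?_⟩
          rw [Bool.or_eq_true, Bool.or_eq_true] at h2
          rcases h2 with (h2 | h2) | h2
          · exact absurd (Nat.eq_of_beq_eq_true h2) h0
          · exact h2
          · exfalso
            refine h.hN (f v) y ?_ hy
            rw [h.gf v hv.1 hv.2]
            exact h2
        · intro a ha b hb hab
          have ha : G.Adj (f v) a := by simpa using ha
          have hb : G.Adj (f v) b := by simpa using hb
          rw [← h.fg a (hcon a ha), ← h.fg b (hcon b hb), hab]
      rw [card_neighborFinset_eq_degree, hreg (f v)] at hle
      omega
    obtain ⟨w, hw, hw0⟩ := this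
    obtain ⟨f', g', h'⟩ := h.new hn1 hw0 hv hw
    have hv2 := hv.2
    exact ih _ _ _ f' g' (h'.closeN hreg ⟨hv.1, by omega⟩) hx


theorem init_rlz {V : Type*} (G : SimpleGraph V) (hconn : G.Connected) (a b : V)
    (hab : G.dist a b = 4) : ∃ f g, Rlz G 5 initA initN f g := by
  classical
  obtain ⟨x1, h01, h1⟩ := exists_step hconn hab
  have step : ∀ x y : V, G.Adj x y → G.dist x b ≤ G.dist y b + 1 := by
    intro x y hxy
    have h3 := hconn.dist_triangle (u := x) (v := y) (w := b)
    have h4 : G.dist x y = 1 := dist_eq_one_iff_adj.mpr hxy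
    omega
  have e1 : G.dist x1 b = 3 := by have := step _ _ h01; omega
  obtain ⟨x2, h12, h2⟩ := exists_step hconn e1
  have e2 : G.dist x2 b = 2 := by have := step _ _ h12; omega
  obtain ⟨x3, h23, h3⟩ := exists_step hconn e2
  have e3 : G.dist x3 b = 1 := by have := step _ _ h23; omega
  have h34 : G.Adj x3 b := dist_eq_one_iff_adj.mp e3
  have e4 : G.dist b b = 0 := by simp
  let f : ℕ → V := fun i => if i = 1 then a else if i = 2 then x1 else if i = 3 then x2 else
    if i = 4 then x3 else b
  have hf : ∀ i, 1 ≤ i → i ≤ 5 → G.dist (f i) b = 5 - i := by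
    intro i hi1 hi5
    interval_cases i <;> simp [f, hab, e1, e2, e3]
  let g : V → ℕ := fun x => if f (5 - G.dist x b) = x then 5 - G.dist x b else 0
  have base : Rlz G 5 0 0 f g := by
    refine ⟨by omega, le_rfl, ?_, ?_, ?_, ?_, ?_, ?_, ?_⟩
    · intro x; dsimp only [g]; split_ifs <;> omega
    · intro x hx
      dsimp only [g] at hx ⊢
      split_ifs at hx ⊢ with h
      · exact h
      · exact absurd rfl hx
    · intro i hi1 hi5
      dsimp only [g]
      rw [hf i hi1 hi5, show 5 - (5 - i) = i by omega, if_pos rfl]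
    · intro i j _ _ h; simp [bitM] at h
    · intro i j h; simp [bitM] at h
    · intro i j _ _ h; simp [bitM] at h
    · simpa [f] using hab
  have ok : ∀ i, 1 ≤ i → i ≤ 5 → okIdx 5 i := fun i h1 h2 => ⟨h1, h2⟩
  refine ⟨f, g, ?_⟩
  have irr := fun x => G.loopless.irrefl x
  unfold initA initN
  have r1 := base.addA (ok 1 (by omega) (by omega)) (ok 2 (by omega) (by omega)) (by simpa [f] using h01)
  have r2 := r1.addA (ok 2 (by omega) (by omega)) (ok 3 (by omega) (by omega)) (by simpa [f] using h12)
  have r3 := r2.addA (ok 3 (by omega) (by omega)) (ok 4 (by omega) (by omega)) (by simpa [f] using h23)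
  have r4 := r3.addA (ok 4 (by omega) (by omega)) (ok 5 (by omega) (by omega)) (by simpa [f] using h34)
  have s1 := r4.addNf (ok 1 (by omega) (by omega)) (ok 1 (by omega) (by omega)) (irr _)
  have s2 := s1.addNf (ok 2 (by omega) (by omega)) (ok 2 (by omega) (by omega)) (irr _)
  have s3 := s2.addNf (ok 3 (by omega) (by omega)) (ok 3 (by omega) (by omega)) (irr _)
  have s4 := s3.addNf (ok 4 (by omega) (by omega)) (ok 4 (by omega) (by omega)) (irr _)
  exact s4.addNf (ok 5 (by omega) (by omega)) (ok 5 (by omega) (by omega)) (irr _)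

/-- A regular NDB graph with valency `4`, diameter `d ≥ 3` and
`γ = d + 1` has `d ≠ 4`. -/
theorem stmt_15 {V : Type*} [Fintype V] (G : SimpleGraph V) [DecidableRel G.Adj]
    (hconn : G.Connected) (d : ℕ) (hreg : G.IsRegularOfDegree 4)
    (hd : 3 ≤ d) (hdiam : HasDiam G d) (hndb : IsNDB G (d + 1)) :
    d ≠ 4 := by
  rintro rfl
  obtain ⟨_, a, b, hab⟩ := hdiam
  obtain ⟨f, g, h⟩ := init_rlz G hconn a b hab
  exact check_sound G hconn hreg hndb ctree 5 initA initN f g h check_ctree
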